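/- Let H = (H_n = (V_n,E_n))_{n∈ℕ} be a sequence of k-uniform hypergraphs, let p = (p_n)_{n∈ℕ} ∈ (0,1)^ℕ, and let K ≥ 1. If H is (K,p)-bounded, then for every i ∈ [k−1] and every η > 0 there exist b > 0 and n₀ such that for every n ≥ n₀ and every q ≥ p_n, with probability at least 1 − 2^{−b·q·|V_n| + 1 + log₂ k}, the binomial random subset (V_n)_q has the property that there exists a set X ⊆ (V_n)_q with |X| ≤ η·q·|V_n| such that Σ_{v ∈ V_n} deg_i²(v, (V_n)_q ∖ X) ≤ 4^k·k²·K·q^{2i}·|E_n|²/|V_n|. -/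

import Mathlib

open Finset Filter

/-- The probability weight of obtaining exactly the subset `S` when each element of the
finite ground set `Γ` is included independently with probability `p`. -/
noncomputable def binomWeight {α : Type*} (Γ : Finset α) (p : ℝ) (S : Finset α) : ℝ :=
  p ^ S.card * (1 - p) ^ (Γ.card - S.card)

open Classical in
/-- The probability that the binomial random subset `Γ_p` satisfies the property `P`. -/
noncomputable def binomProb {α : Type*} (Γ : Finset α) (p : ℝ) (P : Finset α → Prop) : ℝ :=
  ∑ S ∈ Γ.powerset, if P S then binomWeight Γ p S else 0

/-- `deg_i(v, U)`: the number of edges `e` of the hypergraph with edge set `E` such that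
`v ∈ e` and `|e ∩ (U \ {v})| ≥ i`. -/
def degi {α : Type*} [DecidableEq α] (E : Finset (Finset α)) (i : ℕ) (v : α) (U : Finset α) : ℕ :=
  (E.filter fun e => v ∈ e ∧ i ≤ (e ∩ U.erase v).card).card

/-- `μ_i(H, q)`: the expected value of `∑_{v ∈ V} deg_i(v, V_q)²` for the binomial random
subset `V_q` of the vertex set `V` of the hypergraph `H = (V, E)`. -/
noncomputable def mu {α : Type*} [DecidableEq α] (V : Finset α) (E : Finset (Finset α))
    (i : ℕ) (q : ℝ) : ℝ :=
  ∑ S ∈ V.powerset, binomWeight V q S * ∑ v ∈ V, (degi E i v S : ℝ) ^ 2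

/-- A sequence of hypergraphs `(V n, E n)` is `α`-dense. -/
def AlphaDense {α : Type*} [DecidableEq α] (V : ℕ → Finset α) (E : ℕ → Finset (Finset α))
    (a : ℝ) : Prop :=
  ∀ ε : ℝ, 0 < ε → ∃ ζ : ℝ, 0 < ζ ∧ ∃ n₀ : ℕ, ∀ n ≥ n₀, ∀ U ⊆ V n,
    (a + ε) * ((V n).card : ℝ) ≤ (U.card : ℝ) →
    ζ * ((E n).card : ℝ) ≤ (((E n).filter fun e => e ⊆ U).card : ℝ)

/-- A sequence of `k`-uniform hypergraphs `(V n, E n)` is `(K, p)`-bounded. -/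
def KPBounded {α : Type*} [DecidableEq α] (k : ℕ) (V : ℕ → Finset α)
    (E : ℕ → Finset (Finset α)) (K : ℝ) (p : ℕ → ℝ) : Prop :=
  ∀ i : ℕ, 1 ≤ i → i ≤ k - 1 → ∃ n₀ : ℕ, ∀ n ≥ n₀, ∀ q : ℝ, p n ≤ q → q ≤ 1 →
    mu (V n) (E n) i q ≤ K * q ^ (2 * i) * ((E n).card : ℝ) ^ 2 / ((V n).card : ℝ)

theorem binomWeight_nonneg {α : Type*} (Γ : Finset α) {q : ℝ} (hq0 : 0 ≤ q) (hq1 : q ≤ 1)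
    (S : Finset α) : 0 ≤ binomWeight Γ q S :=
  mul_nonneg (pow_nonneg hq0 _) (pow_nonneg (sub_nonneg.2 hq1) _)

theorem sum_binomWeight {α : Type*} (Γ : Finset α) (q : ℝ) :
    ∑ S ∈ Γ.powerset, binomWeight Γ q S = 1 := by
  simp [binomWeight, Finset.sum_pow_mul_eq_add_pow]

theorem binomProb_not {α : Type*} (Γ : Finset α) (q : ℝ) (P : Finset α → Prop) :
    binomProb Γ q (fun S => ¬ P S) = 1 - binomProb Γ q P := by
  rw [eq_sub_iff_add_eq', binomProb, binomProb, ← Finset.sum_add_distrib, ← sum_binomWeight Γ q]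
  refine Finset.sum_congr rfl fun S _ => ?_
  by_cases h : P S <;> simp [h]

theorem binomProb_mono {α : Type*} (Γ : Finset α) {q : ℝ} (hq0 : 0 ≤ q) (hq1 : q ≤ 1)
    {P Q : Finset α → Prop} (h : ∀ S, P S → Q S) : binomProb Γ q P ≤ binomProb Γ q Q := by
  refine Finset.sum_le_sum fun S _ => ?_
  have hw := binomWeight_nonneg Γ hq0 hq1 S
  split_ifs with hP hQ hQ
  · exact le_rfl
  · exact absurd (h S hP) hQ
  · exact hw
  · exact le_rfl

/-- Markov's inequality for the binomial random subset. -/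
theorem binomProb_mul_le {α : Type*} (Γ : Finset α) {q : ℝ} (hq0 : 0 ≤ q) (hq1 : q ≤ 1)
    (P : Finset α → Prop) (g : Finset α → ℝ) (c : ℝ) (hg : ∀ S, 0 ≤ g S)
    (hc : ∀ S ⊆ Γ, P S → c ≤ g S) :
    binomProb Γ q P * c ≤ ∑ S ∈ Γ.powerset, binomWeight Γ q S * g S := by
  rw [binomProb, Finset.sum_mul]
  refine Finset.sum_le_sum fun S hS => ?_
  have hw := binomWeight_nonneg Γ hq0 hq1 S
  split_ifs with h
  · exact mul_le_mul_of_nonneg_left (hc S (Finset.mem_powerset.1 hS) h) hw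
  · simpa using mul_nonneg hw (hg S)

/-- Conditioning the binomial random subset of `Γ` on containing `T`. -/
theorem sum_binomWeight_of_superset {α : Type*} [DecidableEq α] {Γ T : Finset α} (hT : T ⊆ Γ)
    (q : ℝ) (g : Finset α → ℝ) :
    (∑ S ∈ Γ.powerset, if T ⊆ S then binomWeight Γ q S * g (S \ T) else 0) =
      q ^ T.card * ∑ S ∈ (Γ \ T).powerset, binomWeight (Γ \ T) q S * g S := by
  rw [← Finset.sum_filter, Finset.mul_sum]
  refine Finset.sum_bij' (fun S _ => S \ T) (fun S _ => S ∪ T) ?_ ?_ ?_ ?_ ?_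
  · intro S hS
    simp only [Finset.mem_filter, Finset.mem_powerset] at hS ⊢
    exact Finset.sdiff_subset_sdiff hS.1 subset_rfl
  · intro S hS
    simp only [Finset.mem_filter, Finset.mem_powerset] at hS ⊢
    exact ⟨Finset.union_subset (hS.trans Finset.sdiff_subset) hT, Finset.subset_union_right⟩
  · intro S hS
    simp only [Finset.mem_filter, Finset.mem_powerset] at hS
    exact Finset.sdiff_union_of_subset hS.2
  · intro S hS
    rw [Finset.mem_powerset] at hS
    exact Finset.union_sdiff_cancel_right (Finset.disjoint_of_subset_left hS Finset.sdiff_disjoint)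
  · intro S hS
    simp only [Finset.mem_filter, Finset.mem_powerset] at hS
    have h1 := Finset.card_sdiff_add_card_eq_card hS.2
    have h2 := Finset.card_sdiff_add_card_eq_card hT
    rw [binomWeight, binomWeight, ← mul_assoc, ← mul_assoc, ← pow_add, add_comm T.card, h1]
    congr 3
    omega

/-- The number of sequences of `z` members of `Ω` whose associated sets `T ω` are pairwise
disjoint and contained in `S`. -/
def disjointSeqCount {α β : Type*} [DecidableEq α] (Ω : Finset β) (T : β → Finset α) :
    ℕ → Finset α → ℕ
  | 0, _ => 1
  | z + 1, S => ∑ ω ∈ Ω, if T ω ⊆ S then disjointSeqCount Ω T z (S \ T ω) else 0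

theorem sum_binomWeight_mul_disjointSeqCount_le {α β : Type*} [DecidableEq α] (Ω : Finset β)
    (T : β → Finset α) {q : ℝ} (hq0 : 0 ≤ q) (z : ℕ) (Γ : Finset α) :
    ∑ S ∈ Γ.powerset, binomWeight Γ q S * (disjointSeqCount Ω T z S : ℝ) ≤
      (∑ ω ∈ Ω, q ^ (T ω).card) ^ z := by
  induction z generalizing Γ with
  | zero => simp [disjointSeqCount, sum_binomWeight]
  | succ z ih =>
    have h0 : (0 : ℝ) ≤ (∑ ω ∈ Ω, q ^ (T ω).card) ^ z := by positivity
    simp only [disjointSeqCount, Nat.cast_sum, Finset.mul_sum]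
    rw [Finset.sum_comm, pow_succ', Finset.sum_mul]
    refine Finset.sum_le_sum fun ω _ => ?_
    by_cases hω : T ω ⊆ Γ
    · have h := sum_binomWeight_of_superset hω q (fun S => (disjointSeqCount Ω T z S : ℝ))
      simp only [Nat.cast_ite, Nat.cast_zero, mul_ite, mul_zero]
      rw [h]
      exact mul_le_mul_of_nonneg_left (ih _) (pow_nonneg hq0 _)
    · rw [Finset.sum_eq_zero]
      · positivity
      · intro S hS
        rw [if_neg fun h => hω (h.trans (Finset.mem_powerset.1 hS))]
        simp

theorem pow_le_disjointSeqCount {α β : Type*} [DecidableEq α] (Ω : Finset β) (T : β → Finset α)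
    (t : ℕ) (hT : ∀ ω ∈ Ω, (T ω).card ≤ t) {c : ℝ} (hc : 0 ≤ c) (z : ℕ) (S : Finset α)
    (h : ∀ X ⊆ S, X.card ≤ t * z → c ≤ ((Ω.filter fun ω => T ω ⊆ S \ X).card : ℝ)) :
    c ^ z ≤ (disjointSeqCount Ω T z S : ℝ) := by
  induction z generalizing S with
  | zero => simp [disjointSeqCount]
  | succ z ih =>
    have h1 := h ∅ (Finset.empty_subset _) (by simp)
    rw [Finset.sdiff_empty] at h1
    simp only [disjointSeqCount, Nat.cast_sum, Nat.cast_ite, Nat.cast_zero]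
    rw [← Finset.sum_filter, pow_succ']
    calc c * c ^ z ≤ ((Ω.filter fun ω => T ω ⊆ S).card : ℝ) * c ^ z := by gcongr
      _ = ∑ ω ∈ Ω.filter (fun ω => T ω ⊆ S), c ^ z := by simp
      _ ≤ _ := by
        refine Finset.sum_le_sum fun ω hω => ih _ fun X hX hXc => ?_
        rw [Finset.mem_filter] at hω
        rw [sdiff_sdiff_left, Finset.sup_eq_union]
        refine h _ (Finset.union_subset hω.2 (hX.trans Finset.sdiff_subset)) ?_
        have := Finset.card_union_le (T ω) X
        have := hT ω hω.1
        rw [mul_add_one]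
        omega

/-- The deletion method: if the expected number of `T ω` contained in the random set is at most
`M / 2`, then with exponentially small failure probability at most `M` of them survive the
deletion of at most `m` vertices. -/
theorem binomProb_deletion_le {α β : Type*} [DecidableEq α] (Ω : Finset β) (T : β → Finset α)
    (t : ℕ) (hT : ∀ ω ∈ Ω, (T ω).card ≤ t) (Γ : Finset α) {q : ℝ} (hq0 : 0 ≤ q) (hq1 : q ≤ 1)
    {M : ℝ} (hM : 0 < M) (hμ : ∑ ω ∈ Ω, q ^ (T ω).card ≤ M / 2) (z : ℕ) {m : ℝ}
    (hm : ((t * z : ℕ) : ℝ) ≤ m) :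
    binomProb Γ q (fun S => ¬ ∃ X ⊆ S, (X.card : ℝ) ≤ m ∧
      ((Ω.filter fun ω => T ω ⊆ S \ X).card : ℝ) ≤ M) ≤ (1 / 2) ^ z := by
  have hMz : 0 < M ^ z := pow_pos hM z
  refine le_of_mul_le_mul_right ?_ hMz
  refine (binomProb_mul_le Γ hq0 hq1 _ (fun S => (disjointSeqCount Ω T z S : ℝ)) (M ^ z)
    (fun _ => Nat.cast_nonneg _) ?_).trans
    ((sum_binomWeight_mul_disjointSeqCount_le Ω T hq0 z Γ).trans ?_)
  · intro S _ hS
    push Not at hS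
    refine pow_le_disjointSeqCount Ω T t hT hM.le z S fun X hX hXc => (hS X hX ?_).le
    exact le_trans (by exact_mod_cast hXc) hm
  · rw [← mul_pow]
    refine pow_le_pow_left₀ (by positivity) (hμ.trans_eq (by ring)) z

/-- Pairs `(e, Z)` of an edge `e` containing `v` and an `i`-subset `Z` of `e \ {v}`. -/
def rootedSubsets {α : Type*} [DecidableEq α] (E : Finset (Finset α)) (i : ℕ) (v : α) :
    Finset (Σ _ : Finset α, Finset α) :=
  (E.filter fun e => v ∈ e).sigma fun e => (e.erase v).powersetCard i

theorem card_rootedSubsets_filter {α : Type*} [DecidableEq α] (E : Finset (Finset α)) (i : ℕ)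
    (v : α) (S : Finset α) :
    ((rootedSubsets E i v).filter fun x => x.2 ⊆ S).card =
      ∑ e ∈ E.filter (fun e => v ∈ e), ((e ∩ S.erase v).card).choose i := by
  have : (rootedSubsets E i v).filter (fun x => x.2 ⊆ S) =
      (E.filter fun e => v ∈ e).sigma fun e => (e ∩ S.erase v).powersetCard i := by
    ext ⟨e, Z⟩
    simp only [rootedSubsets, Finset.mem_filter, Finset.mem_sigma, Finset.mem_powersetCard,
      Finset.subset_iff, Finset.mem_inter, Finset.mem_erase]
    grind
  rw [this, Finset.card_sigma]
  simp

theorem degi_eq_sum {α : Type*} [DecidableEq α] (E : Finset (Finset α)) (i : ℕ) (v : α)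
    (S : Finset α) :
    degi E i v S =
      ∑ e ∈ E.filter (fun e => v ∈ e), if i ≤ (e ∩ S.erase v).card then 1 else 0 := by
  rw [degi, ← Finset.filter_filter, Finset.card_filter]

theorem degi_le_card_rootedSubsets {α : Type*} [DecidableEq α] (E : Finset (Finset α)) (i : ℕ)
    (v : α) (S : Finset α) :
    degi E i v S ≤ ((rootedSubsets E i v).filter fun x => x.2 ⊆ S).card := by
  rw [degi_eq_sum, card_rootedSubsets_filter]
  refine Finset.sum_le_sum fun e _ => ?_
  split_ifs with h
  · exact Nat.choose_pos h
  · exact Nat.zero_le _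

theorem card_rootedSubsets_le {α : Type*} [DecidableEq α] {E : Finset (Finset α)} {k : ℕ}
    (hE : ∀ e ∈ E, e.card = k) (i : ℕ) (v : α) (S : Finset α) :
    ((rootedSubsets E i v).filter fun x => x.2 ⊆ S).card ≤ 2 ^ (k - 1) * degi E i v S := by
  rw [degi_eq_sum, card_rootedSubsets_filter, Finset.mul_sum]
  refine Finset.sum_le_sum fun e he => ?_
  rw [Finset.mem_filter] at he
  split_ifs with h
  · have hcard : (e ∩ S.erase v).card ≤ k - 1 := by
      rw [← hE e he.1, ← Finset.card_erase_of_mem he.2]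
      refine Finset.card_le_card fun x hx => ?_
      simp only [Finset.mem_inter, Finset.mem_erase] at hx ⊢
      exact ⟨hx.2.1, hx.1⟩
    rw [mul_one]
    exact (Nat.choose_le_two_pow _ _).trans (Nat.pow_le_pow_right two_pos hcard)
  · rw [Nat.choose_eq_zero_of_lt (not_le.1 h), mul_zero]

/-- Pairs of rooted subsets with a common root. -/
def rootedPairs {α : Type*} [DecidableEq α] (V : Finset α) (E : Finset (Finset α)) (i : ℕ) :
    Finset (Σ _ : α, (Σ _ : Finset α, Finset α) × (Σ _ : Finset α, Finset α)) :=
  V.sigma fun v => rootedSubsets E i v ×ˢ rootedSubsets E i v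

theorem card_rootedPairs_filter {α : Type*} [DecidableEq α] (V : Finset α)
    (E : Finset (Finset α)) (i : ℕ) (S : Finset α) :
    ((rootedPairs V E i).filter fun ω => ω.2.1.2 ∪ ω.2.2.2 ⊆ S).card =
      ∑ v ∈ V, ((rootedSubsets E i v).filter fun x => x.2 ⊆ S).card ^ 2 := by
  have : (rootedPairs V E i).filter (fun ω => ω.2.1.2 ∪ ω.2.2.2 ⊆ S) =
      V.sigma fun v => ((rootedSubsets E i v).filter fun x => x.2 ⊆ S) ×ˢ
        ((rootedSubsets E i v).filter fun x => x.2 ⊆ S) := by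
    ext ⟨v, x, y⟩
    simp only [rootedPairs, Finset.mem_filter, Finset.mem_sigma, Finset.mem_product,
      Finset.union_subset_iff]
    tauto
  rw [this, Finset.card_sigma]
  simp [sq]

theorem card_union_le_of_mem_rootedPairs {α : Type*} [DecidableEq α] {V : Finset α}
    {E : Finset (Finset α)} {i : ℕ} :
    ∀ ω ∈ rootedPairs V E i, (ω.2.1.2 ∪ ω.2.2.2).card ≤ 2 * i := by
  rintro ⟨v, ⟨e, Y⟩, ⟨e', Z⟩⟩ hω
  simp only [rootedPairs, rootedSubsets, Finset.mem_sigma, Finset.mem_product,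
    Finset.mem_powersetCard] at hω ⊢
  have := Finset.card_union_le Y Z
  omega

theorem union_subset_of_mem_rootedPairs {α : Type*} [DecidableEq α] {V : Finset α}
    {E : Finset (Finset α)} (hE : ∀ e ∈ E, e ⊆ V) {i : ℕ} :
    ∀ ω ∈ rootedPairs V E i, ω.2.1.2 ∪ ω.2.2.2 ⊆ V := by
  rintro ⟨v, ⟨e, Y⟩, ⟨e', Z⟩⟩ hω
  simp only [rootedPairs, rootedSubsets, Finset.mem_sigma, Finset.mem_product,
    Finset.mem_powersetCard, Finset.mem_filter] at hω ⊢
  obtain ⟨-, ⟨⟨he, -⟩, hY, -⟩, ⟨he', -⟩, hZ, -⟩ := hω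
  exact Finset.union_subset ((hY.trans (Finset.erase_subset _ _)).trans (hE e he))
    ((hZ.trans (Finset.erase_subset _ _)).trans (hE e' he'))

theorem sum_pow_card_eq_expectation {α β : Type*} [DecidableEq α] (Ω : Finset β)
    (T : β → Finset α) {Γ : Finset α} (hT : ∀ ω ∈ Ω, T ω ⊆ Γ) (q : ℝ) :
    ∑ ω ∈ Ω, q ^ (T ω).card =
      ∑ S ∈ Γ.powerset, binomWeight Γ q S * ((Ω.filter fun ω => T ω ⊆ S).card : ℝ) := by
  simp only [Finset.card_filter, Nat.cast_sum, Finset.mul_sum, Nat.cast_ite, Nat.cast_one,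
    Nat.cast_zero, mul_ite, mul_zero]
  rw [Finset.sum_comm]
  refine Finset.sum_congr rfl fun ω hω => ?_
  rw [sum_binomWeight_of_superset (hT ω hω) q fun _ => 1]
  simp [sum_binomWeight]

theorem sum_pow_card_rootedPairs_le {α : Type*} [DecidableEq α] {V : Finset α}
    {E : Finset (Finset α)} {k : ℕ} (hE : ∀ e ∈ E, e.card = k ∧ e ⊆ V) (i : ℕ) {q : ℝ}
    (hq0 : 0 ≤ q) (hq1 : q ≤ 1) :
    ∑ ω ∈ rootedPairs V E i, q ^ (ω.2.1.2 ∪ ω.2.2.2).card ≤ 4 ^ (k - 1) * mu V E i q := by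
  refine (sum_pow_card_eq_expectation (rootedPairs V E i) (fun ω => ω.2.1.2 ∪ ω.2.2.2)
    (union_subset_of_mem_rootedPairs fun e he => (hE e he).2) q).trans_le ?_
  rw [mu, Finset.mul_sum]
  refine Finset.sum_le_sum fun S _ => ?_
  rw [mul_left_comm]
  refine mul_le_mul_of_nonneg_left ?_ (binomWeight_nonneg V hq0 hq1 S)
  rw [card_rootedPairs_filter, Nat.cast_sum, Finset.mul_sum]
  refine Finset.sum_le_sum fun v _ => ?_
  have h : (((rootedSubsets E i v).filter fun x => x.2 ⊆ S).card : ℝ) ≤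
      2 ^ (k - 1) * (degi E i v S : ℝ) := by
    exact_mod_cast card_rootedSubsets_le (fun e he => (hE e he).1) i v S
  rw [Nat.cast_pow]
  calc _ ≤ (2 ^ (k - 1) * (degi E i v S : ℝ)) ^ 2 := pow_le_pow_left₀ (Nat.cast_nonneg _) h 2
    _ = _ := by rw [mul_pow, ← pow_mul, mul_comm (k - 1), pow_mul]; norm_num

/-- Upper-tail proposition: in a `(K, p)`-bounded sequence of `k`-uniform hypergraphs,
after deleting a small set `X` of vertices of the random set, the sum of squared degrees
is bounded, with exponentially small failure probability. -/
theorem upper_tail {α : Type*} [DecidableEq α] (k : ℕ) (hk : 1 ≤ k)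
    (V : ℕ → Finset α) (E : ℕ → Finset (Finset α))
    (hunif : ∀ n, ∀ e ∈ E n, e.card = k ∧ e ⊆ V n)
    (p : ℕ → ℝ) (hp : ∀ n, 0 < p n ∧ p n < 1)
    (K : ℝ) (hK : 1 ≤ K) (hbdd : KPBounded k V E K p)
    (i : ℕ) (hi1 : 1 ≤ i) (hik : i ≤ k - 1) (η : ℝ) (hη : 0 < η) :
    ∃ b : ℝ, 0 < b ∧ ∃ n₀ : ℕ, ∀ n ≥ n₀, ∀ q : ℝ, p n ≤ q → q ≤ 1 →
      1 - (2 : ℝ) ^ (-(b * q * ((V n).card : ℝ)) + 1 + Real.logb 2 (k : ℝ)) ≤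
        binomProb (V n) q (fun S => ∃ X ⊆ S, (X.card : ℝ) ≤ η * q * ((V n).card : ℝ) ∧
          (∑ v ∈ V n, (degi (E n) i v (S \ X) : ℝ) ^ 2) ≤
            (4 : ℝ) ^ k * (k : ℝ) ^ 2 * K * q ^ (2 * i) *
              ((E n).card : ℝ) ^ 2 / ((V n).card : ℝ)) := by
  obtain ⟨n₀, hn₀⟩ := hbdd i hi1 hik
  have hi : (0 : ℝ) < 2 * i := by positivity
  refine ⟨η / (2 * i), by positivity, n₀, fun n hn q hpq hq1 => ?_⟩
  have hq0 : 0 < q := (hp n).1.trans_le hpq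
  rw [sub_le_comm, ← binomProb_not]
  rcases (E n).eq_empty_or_nonempty with hE | ⟨e, he⟩
  · refine le_trans (Finset.sum_nonpos fun S _ => ?_) (Real.rpow_nonneg two_pos.le _)
    rw [if_neg]
    exact not_not_intro ⟨∅, Finset.empty_subset _, by simp; positivity, by simp [hE, degi]⟩
  · have hV : 0 < (V n).card := by
      have := Finset.card_le_card (hunif n e he).2
      rw [(hunif n e he).1] at this
      omega
    have hE : 0 < (E n).card := Finset.card_pos.2 ⟨e, he⟩
    set B : ℝ := K * q ^ (2 * i) * ((E n).card : ℝ) ^ 2 / ((V n).card : ℝ) with hB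
    have hBpos : 0 < B := by positivity
    have hμ : ∑ ω ∈ rootedPairs (V n) (E n) i, q ^ (ω.2.1.2 ∪ ω.2.2.2).card ≤ 4 ^ k * B / 2 := by
      refine (sum_pow_card_rootedPairs_le (hunif n) i hq0.le hq1).trans ?_
      have h4 : (4 : ℝ) ^ k = 4 * 4 ^ (k - 1) := by rw [← pow_succ', Nat.sub_add_cancel hk]
      rw [h4]
      have := mul_le_mul_of_nonneg_left (hn₀ n hn q hpq hq1) (by positivity : (0 : ℝ) ≤ 4 ^ (k - 1))
      have : 0 < (4 : ℝ) ^ (k - 1) * B := by positivity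
      linarith
    set m : ℝ := η * q * ((V n).card : ℝ) with hm
    have hm0 : 0 ≤ m / (2 * i) := by positivity
    have hz : ((2 * i * ⌊m / (2 * i)⌋₊ : ℕ) : ℝ) ≤ m := by
      have := (le_div_iff₀' hi).1 (Nat.floor_le hm0)
      exact_mod_cast this
    have hdel := binomProb_deletion_le (rootedPairs (V n) (E n) i) (fun ω => ω.2.1.2 ∪ ω.2.2.2)
      (2 * i) card_union_le_of_mem_rootedPairs (V n) hq0.le hq1 (by positivity) hμ _ hz
    refine le_trans (binomProb_mono (V n) hq0.le hq1 fun S hS => ?_) (hdel.trans ?_)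
    · rintro ⟨X, hX, hXm, hXM⟩
      refine hS ⟨X, hX, hXm, ?_⟩
      have hdeg : ∑ v ∈ V n, (degi (E n) i v (S \ X) : ℝ) ^ 2 ≤ 4 ^ k * B := by
        refine le_trans ?_ hXM
        rw [card_rootedPairs_filter]
        push_cast
        gcongr
        exact degi_le_card_rootedSubsets _ _ _ _
      have hk2 : (1 : ℝ) ≤ (k : ℝ) ^ 2 := one_le_pow₀ (by exact_mod_cast hk)
      calc _ ≤ 4 ^ k * B := hdeg
        _ ≤ (k : ℝ) ^ 2 * (4 ^ k * B) := le_mul_of_one_le_left (by positivity) hk2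
        _ = _ := by rw [hB]; ring
    · have hlog : 0 ≤ Real.logb 2 (k : ℝ) :=
        Real.logb_nonneg one_lt_two (by exact_mod_cast hk)
      rw [one_div, inv_pow, ← Real.rpow_natCast, ← Real.rpow_neg two_pos.le]
      refine Real.rpow_le_rpow_of_exponent_le one_le_two ?_
      have hfl := Nat.lt_floor_add_one (m / (2 * i))
      have : η / (2 * i) * q * ((V n).card : ℝ) = m / (2 * i) := by rw [hm]; ring
      rw [this]
      linarith
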